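/- arXiv:1606.07504 — 2 statements merged into one kernel-verified Lean document; each statement's English description precedes it below -/
import Mathlib

section
/- Generalized conformable fractional Euler–Lagrange equation: let 0 < α ≤ 1, a < b, and L : [a,b]×ℝ×ℝ×ℝ → ℝ be of class C¹. Let y : [a,b] → ℝ be continuously differentiable, so that y^(α)_a(x) = (x−a)^{1−α}y′(x). Define L̃(x,y,u,v) = (x−a)^{1−α} L(x,y,u,v), and assume that x ↦ (∂L/∂u)(x,y(x),y′(x),y^(α)_a(x)) is differentiable and that x ↦ (∂L̃/∂v)(x,y(x),y′(x),y^(α)_a(x)) is left α-differentiable on (a,b). Suppose that for every continuously differentiable η : [a,b] → ℝ with η(a) = η(b) = 0, the function ε ↦ ∫_a^b L(x, y+εη, y′+εη′, y^(α)_a+εη^(α)_a) dx has derivative 0 at ε = 0. Then for all x ∈ (a,b): (∂L/∂y) − (d/dx)(∂L/∂u) − (x−a)^{α−1} (d^α_a/dx^α)[(∂L̃/∂v)] = 0, where all partial derivatives of L and L̃ are evaluated at (x, y(x), y′(x), y^(α)_a(x)). -/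
open Topology Filter MeasureTheory

/-- `f` has left conformable fractional derivative `l` of order `α` starting from `a`,
at the point `x`. -/
def HasConfDerivAt (α a : ℝ) (f : ℝ → ℝ) (l x : ℝ) : Prop :=
  Filter.Tendsto (fun ε : ℝ => (f (x + ε * (x - a) ^ (1 - α)) - f x) / ε)
    (𝓝[≠] (0 : ℝ)) (𝓝 l)

/-- Away from the base point, a conformable derivative is a rescaled ordinary derivative. -/
theorem HasConfDerivAt.hasDerivAt {α a l x : ℝ} {f : ℝ → ℝ}
    (h : HasConfDerivAt α a f l x) (hx : a < x) :
    HasDerivAt f ((x - a) ^ (α - 1) * l) x := by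
  have hxa : 0 < x - a := sub_pos.mpr hx
  have hk : 0 < (x - a) ^ (1 - α) := Real.rpow_pos_of_pos hxa _
  have hinv : (x - a) ^ (α - 1) = ((x - a) ^ (1 - α))⁻¹ := by
    rw [← Real.rpow_neg hxa.le, neg_sub]
  rw [hasDerivAt_iff_tendsto_slope_zero, hinv]
  unfold HasConfDerivAt at h
  generalize (x - a) ^ (1 - α) = k at *
  have hscale : Tendsto (fun t : ℝ => t / k) (𝓝[≠] 0) (𝓝[≠] 0) := by
    refine tendsto_nhdsWithin_iff.mpr ⟨?_, ?_⟩
    · have : Tendsto (fun t : ℝ => t / k) (𝓝 0) (𝓝 (0 / k)) := tendsto_id.div_const k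
      rw [zero_div] at this
      exact this.mono_left nhdsWithin_le_nhds
    · filter_upwards [self_mem_nhdsWithin] with t ht
      exact div_ne_zero ht hk.ne'
  refine ((h.comp hscale).const_mul k⁻¹).congr' ?_
  filter_upwards [self_mem_nhdsWithin] with t ht
  have ht' : t ≠ 0 := ht
  simp only [Function.comp_apply, smul_eq_mul, div_mul_cancel₀ _ hk.ne']
  field_simp

/-- Differentiation under the integral sign along a line in the direction of a continuous
curve `w`, based at a continuous curve `p`. -/
theorem hasDerivAt_intervalIntegral_line {E : Type*} [NormedAddCommGroup E] [NormedSpace ℝ E]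
    {F : E → ℝ} (hF : ContDiff ℝ 1 F) {p w : ℝ → E} (hp : Continuous p) (hw : Continuous w)
    (a b : ℝ) :
    HasDerivAt (fun ε : ℝ => ∫ x in a..b, F (p x + ε • w x))
      (∫ x in a..b, fderiv ℝ F (p x) (w x)) 0 := by
  have hF' : Continuous (fderiv ℝ F) := hF.continuous_fderiv one_ne_zero
  have hcont : Continuous fun z : ℝ × ℝ => fderiv ℝ F (p z.2 + z.1 • w z.2) (w z.2) := by
    fun_prop
  have hFc : Continuous F := hF.continuous
  obtain ⟨C, hC⟩ := ((isCompact_closedBall (0 : ℝ) 1).prod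
    (isCompact_uIcc (a := a) (b := b))).exists_bound_of_continuousOn hcont.continuousOn
  have key := intervalIntegral.hasDerivAt_integral_of_dominated_loc_of_deriv_le
    (μ := volume) (a := a) (b := b) (x₀ := (0 : ℝ)) (s := Metric.closedBall 0 1)
    (F := fun ε x => F (p x + ε • w x))
    (F' := fun ε x => fderiv ℝ F (p x + ε • w x) (w x)) (bound := fun _ => C)
    (Metric.closedBall_mem_nhds _ one_pos)
    (.of_forall fun ε => (by fun_prop : Continuous fun x =>
      F (p x + ε • w x)).aestronglyMeasurable)
    ((by fun_prop : Continuous fun x => F (p x + (0 : ℝ) • w x)).intervalIntegrable _ _)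
    (by fun_prop : Continuous fun x =>
      fderiv ℝ F (p x + (0 : ℝ) • w x) (w x)).aestronglyMeasurable
    (.of_forall fun x hx ε hε => hC (ε, x) ⟨hε, Set.uIoc_subset_uIcc hx⟩)
    intervalIntegrable_const
    (.of_forall fun x _ ε _ => by
      have hline : HasDerivAt (fun ε : ℝ => p x + ε • w x) (w x) ε := by
        simpa using ((hasDerivAt_id ε).smul_const (w x)).const_add (p x)
      exact ((hF.differentiable one_ne_zero _).hasFDerivAt).comp_hasDerivAt ε hline)
  simpa using key.2

/-- The lemma of du Bois-Reymond. -/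
theorem hasDerivAt_of_forall_integral_eq_zero {a b : ℝ} (hab : a < b) {P Q : ℝ → ℝ}
    (hP : Continuous P) (hQ : Continuous Q)
    (h : ∀ η η' : ℝ → ℝ, (∀ x, HasDerivAt η (η' x) x) → Continuous η' → η a = 0 → η b = 0 →
      ∫ x in a..b, (P x * η x + Q x * η' x) = 0) :
    ∀ x ∈ Set.Ioo a b, HasDerivAt Q (P x) x := by
  set G : ℝ → ℝ := fun x => ∫ t in a..x, P t
  have hG : ∀ x, HasDerivAt G (P x) x := fun x => hP.integral_hasStrictDerivAt a x |>.hasDerivAt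
  have hGc : Continuous G := continuous_iff_continuousAt.mpr fun x => (hG x).continuousAt
  set m : ℝ := (∫ x in a..b, (Q x - G x)) / (b - a) with hm
  set η' : ℝ → ℝ := fun x => Q x - G x - m with hη'
  have hη'c : Continuous η' := by fun_prop
  set η : ℝ → ℝ := fun x => ∫ t in a..x, η' t with hηdef
  have hη : ∀ x, HasDerivAt η (η' x) x :=
    fun x => hη'c.integral_hasStrictDerivAt a x |>.hasDerivAt
  have hηc : Continuous η := continuous_iff_continuousAt.mpr fun x => (hη x).continuousAt
  have hηa : η a = 0 := intervalIntegral.integral_same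
  have hηb : η b = 0 := by
    have : b - a ≠ 0 := (sub_pos.mpr hab).ne'
    simp only [hηdef, hη']
    rw [intervalIntegral.integral_sub
      ((by fun_prop : Continuous fun x => Q x - G x).intervalIntegrable _ _)
      intervalIntegrable_const, intervalIntegral.integral_const, smul_eq_mul, hm,
      mul_div_cancel₀ _ this, sub_self]
  have hvar := h η η' hη hη'c hηa hηb
  have hparts : ∫ x in a..b, (P x * η x + (G x + m) * η' x) = 0 := by
    rw [intervalIntegral.integral_eq_sub_of_hasDerivAt (f := fun x => (G x + m) * η x)
      (fun x _ => ((hG x).add_const m).mul (hη x))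
      ((by fun_prop : Continuous _).intervalIntegrable _ _), hηa, hηb]
    simp
  have hsq : ∫ x in a..b, η' x ^ 2 = 0 := by
    rw [← sub_eq_zero.mpr (hvar.trans hparts.symm), ← intervalIntegral.integral_sub
      ((by fun_prop : Continuous _).intervalIntegrable _ _)
      ((by fun_prop : Continuous _).intervalIntegrable _ _)]
    congr 1 with x
    simp only [hη']
    ring
  have hzero : ∀ x ∈ Set.Icc a b, η' x = 0 := by
    intro x hx
    by_contra hne
    exact (intervalIntegral.integral_pos hab (hη'c.pow 2).continuousOn
      (fun t _ => sq_nonneg _) ⟨x, hx, sq_pos_of_ne_zero hne⟩).ne' hsq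
  intro x hx
  refine ((hG x).add_const m).congr_of_eventuallyEq ?_
  filter_upwards [Icc_mem_nhds hx.1 hx.2] with t ht
  linarith [hzero t ht]

/-- Generalized conformable fractional Euler–Lagrange equation, for Lagrangians
`L(x, y, y′, y^{(α)}_a)` depending on both the ordinary and the conformable derivative.
Here `y` is continuously differentiable, so `y^{(α)}_a(x) = (x−a)^{1−α} y′(x)`, the
functional is `J(y) = ∫_a^b L(x, y, y′, y^{(α)}_a) dx`, `q′` is the ordinary derivative
of `x ↦ ∂L/∂u(x,y,y′,y^{(α)}_a)` and `rα` is the conformable derivative of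
`x ↦ ∂L̃/∂v(x,y,y′,y^{(α)}_a)` with `L̃ = (x−a)^{1−α} L`. -/
theorem generalized_conformable_euler_lagrange
    (α a b : ℝ) (hα0 : 0 < α) (hα1 : α ≤ 1) (hab : a < b)
    (L : ℝ → ℝ → ℝ → ℝ → ℝ)
    (hL : ContDiff ℝ 1 (fun q : ℝ × ℝ × ℝ × ℝ => L q.1 q.2.1 q.2.2.1 q.2.2.2))
    (y y' : ℝ → ℝ)
    (hy : ∀ x ∈ Set.Icc a b, HasDerivAt y (y' x) x)
    (hy' : ContinuousOn y' (Set.Icc a b))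
    (q' : ℝ → ℝ)
    (hq : ∀ x ∈ Set.Ioo a b, HasDerivAt
      (fun t => deriv (fun u => L t (y t) u ((t - a) ^ (1 - α) * y' t)) (y' t)) (q' x) x)
    (rα : ℝ → ℝ)
    (hr : ∀ x ∈ Set.Ioo a b, HasConfDerivAt α a
      (fun t => deriv (fun v => (t - a) ^ (1 - α) * L t (y t) (y' t) v)
        ((t - a) ^ (1 - α) * y' t)) (rα x) x)
    (hvar : ∀ η η' : ℝ → ℝ,
      (∀ x ∈ Set.Icc a b, HasDerivAt η (η' x) x) →
      ContinuousOn η' (Set.Icc a b) → η a = 0 → η b = 0 →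
      HasDerivAt (fun ε : ℝ => ∫ x in a..b,
        L x (y x + ε * η x) (y' x + ε * η' x)
          ((x - a) ^ (1 - α) * y' x + ε * ((x - a) ^ (1 - α) * η' x))) 0 0) :
    ∀ x ∈ Set.Ioo a b,
      deriv (fun u => L x u (y' x) ((x - a) ^ (1 - α) * y' x)) (y x)
        - q' x - (x - a) ^ (α - 1) * rα x = 0 := by
  set Φ : ℝ × ℝ × ℝ × ℝ → ℝ := fun q => L q.1 q.2.1 q.2.2.1 q.2.2.2 with hΦ
  have hΦ' : Continuous (fderiv ℝ Φ) := hL.continuous_fderiv one_ne_zero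
  have hΦd : ∀ q, HasFDerivAt Φ (fderiv ℝ Φ q) q :=
    fun q => (hL.differentiable one_ne_zero q).hasFDerivAt
  set c : ℝ → ℝ := fun x => (x - a) ^ (1 - α) with hc
  have hcc : Continuous c :=
    (continuous_id.sub continuous_const).rpow_const fun _ => .inr (sub_nonneg.mpr hα1)
  set z : ℝ → ℝ := Set.IccExtend hab.le ((Set.Icc a b).domRestrict y)
  set z' : ℝ → ℝ := Set.IccExtend hab.le ((Set.Icc a b).domRestrict y')
  have hyc : ContinuousOn y (Set.Icc a b) := fun x hx => (hy x hx).continuousAt.continuousWithinAt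
  have hzc : Continuous z := hyc.domRestrict.Icc_extend'
  have hzc' : Continuous z' := hy'.domRestrict.Icc_extend'
  have hz : ∀ x ∈ Set.Icc a b, z x = y x := fun x hx => Set.IccExtend_of_mem hab.le _ hx
  have hz' : ∀ x ∈ Set.Icc a b, z' x = y' x := fun x hx => Set.IccExtend_of_mem hab.le _ hx
  set p : ℝ → ℝ × ℝ × ℝ × ℝ := fun x => (x, z x, z' x, c x * z' x) with hp
  have hpc : Continuous p := by fun_prop
  have hpy : ∀ x ∈ Set.Icc a b, p x = (x, y x, y' x, c x * y' x) := fun x hx => by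
    simp only [hp, hz x hx, hz' x hx]
  set P : ℝ → ℝ := fun x => fderiv ℝ Φ (p x) (0, 1, 0, 0) with hP
  set A : ℝ → ℝ := fun x => fderiv ℝ Φ (p x) (0, 0, 1, 0) with hA
  set B : ℝ → ℝ := fun x => c x * fderiv ℝ Φ (p x) (0, 0, 0, 1) with hB
  have hPc : Continuous P := by fun_prop
  have hABc : Continuous fun x => A x + B x := by fun_prop
  have hEL := hasDerivAt_of_forall_integral_eq_zero hab hPc hABc fun η η' hη hη'c hηa hηb => by
    have hηc : Continuous η := continuous_iff_continuousAt.mpr fun x => (hη x).continuousAt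
    have hline := hasDerivAt_intervalIntegral_line hL hpc
      (w := fun x => (0, η x, η' x, c x * η' x)) (by fun_prop) a b
    have hzero := hvar η η' (fun x _ => hη x) hη'c.continuousOn hηa hηb
    have hsame : (fun ε : ℝ => ∫ x in a..b, Φ (p x + ε • (0, η x, η' x, c x * η' x))) =
        fun ε : ℝ => ∫ x in a..b, L x (y x + ε * η x) (y' x + ε * η' x)
          (c x * y' x + ε * (c x * η' x)) := by
      ext ε
      refine intervalIntegral.integral_congr fun x hx => ?_
      rw [Set.uIcc_of_le hab.le] at hx
      simp [hpy x hx, hΦ]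
    rw [hsame] at hline
    rw [← hline.unique hzero]
    congr 1 with x
    have hsplit : ((0, η x, η' x, c x * η' x) : ℝ × ℝ × ℝ × ℝ) =
        η x • (0, 1, 0, 0) + η' x • (0, 0, 1, 0) + (c x * η' x) • (0, 0, 0, 1) := by
      simp
    rw [hsplit, map_add, map_add, map_smul, map_smul, map_smul]
    simp only [hP, hA, hB, smul_eq_mul]
    ring
  intro x hx
  have hLy : deriv (fun u => L x u (y' x) (c x * y' x)) (y x) = P x := by
    have hcurve : HasDerivAt (fun u : ℝ => (x, u, y' x, c x * y' x)) (0, 1, 0, 0) (y x) :=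
      (hasDerivAt_const _ _).prodMk ((hasDerivAt_id _).prodMk (hasDerivAt_const _ _))
    simp only [hP, hpy x (Set.Ioo_subset_Icc_self hx)]
    exact ((hΦd _).comp_hasDerivAt (y x) hcurve).deriv
  have hLu : ∀ t ∈ Set.Icc a b, A t = deriv (fun u => L t (y t) u (c t * y' t)) (y' t) := by
    intro t ht
    have hcurve : HasDerivAt (fun u : ℝ => (t, y t, u, c t * y' t)) (0, 0, 1, 0) (y' t) :=
      (hasDerivAt_const _ _).prodMk ((hasDerivAt_const _ _).prodMk
        ((hasDerivAt_id _).prodMk (hasDerivAt_const _ _)))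
    simp only [hA, hpy t ht]
    exact ((hΦd _).comp_hasDerivAt (y' t) hcurve).deriv.symm
  have hLv : ∀ t ∈ Set.Icc a b,
      B t = deriv (fun v => c t * L t (y t) (y' t) v) (c t * y' t) := by
    intro t ht
    have hcurve : HasDerivAt (fun v : ℝ => (t, y t, y' t, v)) (0, 0, 0, 1) (c t * y' t) :=
      (hasDerivAt_const _ _).prodMk ((hasDerivAt_const _ _).prodMk
        ((hasDerivAt_const _ _).prodMk (hasDerivAt_id _)))
    simp only [hB, hpy t ht]
    exact (((hΦd _).comp_hasDerivAt (c t * y' t) hcurve).const_mul (c t)).deriv.symm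
  have hsum : HasDerivAt (fun t => A t + B t) (q' x + (x - a) ^ (α - 1) * rα x) x := by
    refine ((hq x hx).add ((hr x hx).hasDerivAt hx.1)).congr_of_eventuallyEq ?_
    filter_upwards [Icc_mem_nhds hx.1 hx.2] with t ht
    simp only [Pi.add_apply, hLu t ht, hLv t ht, hc]
  change deriv (fun u => L x u (y' x) (c x * y' x)) (y x) - _ - _ = 0
  rw [hLy, (hEL x hx).unique hsum]
  ring
end

section
/- Let 0 < α ≤ 1, a < b, and L : ℝ×ℝ → ℝ be of class C¹ (an autonomous Lagrangian L = L(y,v), independent of x). Let y : [a,b] → ℝ be left α-differentiable with conformable derivative y^(α)_a, assume y^(α)_a is left α-differentiable on (a,b), and assume p(x) = (∂L/∂v)(y(x),y^(α)_a(x)) is left α-differentiable on (a,b). If y satisfies the Euler–Lagrange equation (∂L/∂y)(y(x),y^(α)_a(x)) − p^(α)_a(x) = 0 on (a,b), then (d^α_a/dx^α)[ L(y(x),y^(α)_a(x)) − p(x)·y^(α)_a(x) ] = 0 for all x ∈ (a,b); in particular x ↦ L(y(x),y^(α)_a(x)) − p(x)y^(α)_a(x) is constant on (a,b). -/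
open Topology Filter

theorem hasConfDerivAt_iff_hasDerivAt {α a x l : ℝ} {f : ℝ → ℝ} (hx : a < x) :
    HasConfDerivAt α a f l x ↔ HasDerivAt f (l / (x - a) ^ (1 - α)) x := by
  have hc : (x - a) ^ (1 - α) ≠ 0 := (Real.rpow_pos_of_pos (sub_pos.2 hx) _).ne'
  unfold HasConfDerivAt
  generalize (x - a) ^ (1 - α) = c at hc ⊢
  have key : Tendsto (fun ε : ℝ => (f (x + ε * c) - f x) / ε) (𝓝[≠] 0) (𝓝 l) ↔
      HasDerivAt (fun ε : ℝ => f (x + ε * c)) l 0 := by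
    rw [hasDerivAt_iff_tendsto_slope_zero]
    simp [div_eq_inv_mul]
  rw [key]
  constructor
  · intro h
    have hinner : HasDerivAt (fun t : ℝ => (t - x) / c) (1 / c) x :=
      ((hasDerivAt_id x).sub_const x).div_const c
    have h' := HasDerivAt.comp x (h₂ := fun ε : ℝ => f (x + ε * c)) (by simpa using h) hinner
    have hcomp : (fun ε : ℝ => f (x + ε * c)) ∘ (fun t : ℝ => (t - x) / c) = f := by
      funext t
      simp [div_mul_cancel₀ _ hc]
    rwa [hcomp, mul_one_div] at h'
  · intro h
    have hinner : HasDerivAt (fun ε : ℝ => x + ε * c) c 0 := by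
      simpa using ((hasDerivAt_id (0 : ℝ)).mul_const c).const_add x
    have h' := HasDerivAt.comp (0 : ℝ) (h₂ := f) (by simpa using h) hinner
    rwa [div_mul_cancel₀ _ hc] at h'

/-- The chain rule along a curve, in terms of one-variable partial derivatives. -/
theorem hasDerivAt_comp_curve {L : ℝ → ℝ → ℝ} {u v : ℝ → ℝ} {u' v' x : ℝ}
    (hL : DifferentiableAt ℝ (fun q : ℝ × ℝ => L q.1 q.2) (u x, v x))
    (hu : HasDerivAt u u' x) (hv : HasDerivAt v v' x) :
    HasDerivAt (fun t => L (u t) (v t))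
      (deriv (fun s => L s (v x)) (u x) * u' + deriv (fun s => L (u x) s) (v x) * v') x := by
  have hF := hL.hasFDerivAt
  have hfst : HasDerivAt (fun s => L s (v x))
      (fderiv ℝ (fun q : ℝ × ℝ => L q.1 q.2) (u x, v x) (1, 0)) (u x) :=
    HasFDerivAt.comp_hasDerivAt (l := fun q : ℝ × ℝ => L q.1 q.2) (u x) hF
      ((hasDerivAt_id (u x)).prodMk (hasDerivAt_const (u x) (v x)))
  have hsnd : HasDerivAt (fun s => L (u x) s)
      (fderiv ℝ (fun q : ℝ × ℝ => L q.1 q.2) (u x, v x) (0, 1)) (v x) :=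
    HasFDerivAt.comp_hasDerivAt (l := fun q : ℝ × ℝ => L q.1 q.2) (v x) hF
      ((hasDerivAt_const (v x) (u x)).prodMk (hasDerivAt_id (v x)))
  have hcurve : HasDerivAt (fun t => L (u t) (v t))
      (fderiv ℝ (fun q : ℝ × ℝ => L q.1 q.2) (u x, v x) (u', v')) x :=
    HasFDerivAt.comp_hasDerivAt (l := fun q : ℝ × ℝ => L q.1 q.2) x hF (hu.prodMk hv)
  have hdecomp : ((u', v') : ℝ × ℝ) = u' • (1, 0) + v' • (0, 1) := by simp
  rw [hfst.deriv, hsnd.deriv]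
  rw [hdecomp, map_add, map_smul, map_smul, smul_eq_mul, smul_eq_mul] at hcurve
  convert hcurve using 1
  ring

/-- Autonomous conformable DuBois–Reymond condition: for an autonomous Lagrangian
`L = L(y,v)`, along any solution of the conformable Euler–Lagrange equation the quantity
`L(y,y^{(α)}_a) − (∂L/∂v)·y^{(α)}_a` has vanishing conformable derivative on `(a,b)`;
in particular it is constant on `(a,b)`. -/
theorem conformable_duBois_Reymond_autonomous
    (α a b : ℝ) (hα0 : 0 < α) (hα1 : α ≤ 1) (hab : a < b)
    (L : ℝ → ℝ → ℝ)
    (hL : ContDiff ℝ 1 (fun q : ℝ × ℝ => L q.1 q.2))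
    (y yα yαα p pα : ℝ → ℝ)
    (hy : ∀ x ∈ Set.Icc a b, HasConfDerivAt α a y (yα x) x)
    (hyα : ∀ x ∈ Set.Ioo a b, HasConfDerivAt α a yα (yαα x) x)
    (hpdef : ∀ x, p x = deriv (fun v => L (y x) v) (yα x))
    (hpα : ∀ x ∈ Set.Ioo a b, HasConfDerivAt α a p (pα x) x)
    (hEL : ∀ x ∈ Set.Ioo a b, deriv (fun u => L u (yα x)) (y x) - pα x = 0) :
    (∀ x ∈ Set.Ioo a b,
      HasConfDerivAt α a (fun t => L (y t) (yα t) - p t * yα t) 0 x) ∧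
    (∀ x₁ ∈ Set.Ioo a b, ∀ x₂ ∈ Set.Ioo a b,
      L (y x₁) (yα x₁) - p x₁ * yα x₁ = L (y x₂) (yα x₂) - p x₂ * yα x₂) := by
  have hderiv : ∀ x ∈ Set.Ioo a b,
      HasDerivAt (fun t => L (y t) (yα t) - p t * yα t) 0 x := by
    intro x hx
    have hy' := (hasConfDerivAt_iff_hasDerivAt hx.1).1 (hy x (Set.Ioo_subset_Icc_self hx))
    have hyα' := (hasConfDerivAt_iff_hasDerivAt hx.1).1 (hyα x hx)
    have hp' := (hasConfDerivAt_iff_hasDerivAt hx.1).1 (hpα x hx)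
    have hL' := hasDerivAt_comp_curve (hL.differentiable one_ne_zero _) hy' hyα'
    refine (hL'.sub (hp'.mul hyα')).congr_deriv ?_
    rw [← hpdef x, sub_eq_zero.1 (hEL x hx)]
    ring
  refine ⟨fun x hx => (hasConfDerivAt_iff_hasDerivAt hx.1).2 (by simpa using hderiv x hx), ?_⟩
  intro x₁ h₁ x₂ h₂
  exact isOpen_Ioo.is_const_of_deriv_eq_zero isPreconnected_Ioo
    (fun x hx => (hderiv x hx).differentiableAt.differentiableWithinAt)
    (fun x hx => (hderiv x hx).deriv) h₁ h₂
end
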